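/- arXiv:hep-th/9503066 — 3 statements merged into one kernel-verified Lean document; each statement's English description precedes it below -/
import Mathlib

section
/- Let A be a Poisson algebra (a commutative ring with an additive, antisymmetric bracket satisfying Jacobi and Leibniz). Let P be an n×n matrix and Q an n'×n' matrix over A, and suppose there exist (n·n')×(n·n') matrices D₁₂ and D₂₁ over A such that the tensor Poisson bracket satisfies {P ⊗, Q} = [D₁₂, P⊗I] + [D₂₁, I⊗Q]. Then all spectral invariants are in involution: for all integers k, m ≥ 1, {tr(P^k), tr(Q^m)} = 0. -/
open Matrix Kronecker

/-- A Poisson algebra: a commutative ring with an additive, antisymmetric bracket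
satisfying the Jacobi identity and the Leibniz rule. -/
structure PoissonR (A : Type*) [CommRing A] where
  br : A → A → A
  add_left : ∀ x y z : A, br (x + y) z = br x z + br y z
  add_right : ∀ x y z : A, br x (y + z) = br x y + br x z
  antisymm : ∀ x y : A, br x y = - br y x
  jacobi : ∀ x y z : A, br x (br y z) + br y (br z x) + br z (br x y) = 0
  leibniz : ∀ x y z : A, br x (y * z) = br x y * z + y * br x z

/-- Matrix commutator. -/
def mcomm {A ι : Type*} [CommRing A] [Fintype ι] [DecidableEq ι]
    (X Y : Matrix ι ι A) : Matrix ι ι A :=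
  X * Y - Y * X

/-- The Hamiltonian derivation `{x, ·}` of a Poisson algebra. -/
def PoissonR.hamiltonian {A : Type*} [CommRing A] (P : PoissonR A) (x : A) :
    Derivation ℤ A A :=
  Derivation.mk' (AddMonoidHom.mk' (P.br x) (P.add_right x)).toIntLinearMap fun a b => by
    simp only [AddMonoidHom.coe_toIntLinearMap, AddMonoidHom.mk'_apply, P.leibniz, smul_eq_mul]
    ring

@[simp]
theorem PoissonR.hamiltonian_apply {A : Type*} [CommRing A] (P : PoissonR A) (x y : A) :
    P.hamiltonian x y = P.br x y :=
  rfl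

theorem Derivation.map_matrix_mul {A ι : Type*} [CommRing A] [Fintype ι]
    (d : Derivation ℤ A A) (M N : Matrix ι ι A) :
    (M * N).map d = M.map d * N + M * N.map d := by
  ext i j
  simp only [Matrix.map_apply, Matrix.mul_apply, Matrix.add_apply, map_sum, Derivation.leibniz,
    smul_eq_mul, ← Finset.sum_add_distrib]
  exact Finset.sum_congr rfl fun _ _ => by ring

theorem Derivation.trace_mul_map_pow_succ {A ι : Type*} [CommRing A] [Fintype ι] [DecidableEq ι]
    (d : Derivation ℤ A A) (M : Matrix ι ι A) (k : ℕ) (X : Matrix ι ι A) (hX : Commute X M) :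
    (X * (M ^ (k + 1)).map d).trace = (k + 1) * (X * M ^ k * M.map d).trace := by
  induction k generalizing X with
  | zero => simp
  | succ k ih =>
    have hMX : M * X * M ^ k = X * M ^ (k + 1) := by
      rw [← hX.eq, mul_assoc, ← pow_succ']
    rw [pow_succ M (k + 1), d.map_matrix_mul, mul_add, Matrix.trace_add, ← mul_assoc,
      Matrix.trace_mul_comm, ← mul_assoc, ih _ ((Commute.refl M).mul_left hX), hMX, ← mul_assoc]
    push_cast
    ring

theorem Derivation.map_trace_pow_succ {A ι : Type*} [CommRing A] [Fintype ι] [DecidableEq ι]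
    (d : Derivation ℤ A A) (M : Matrix ι ι A) (k : ℕ) :
    d (M ^ (k + 1)).trace = (k + 1) * (M ^ k * M.map d).trace := by
  have h := d.trace_mul_map_pow_succ M k 1 (Commute.one_left M)
  rw [one_mul, one_mul] at h
  rw [← h]
  simp [Matrix.trace]

theorem trace_mul_mcomm_of_commute {A ι : Type*} [CommRing A] [Fintype ι] [DecidableEq ι]
    {X Y : Matrix ι ι A} (D : Matrix ι ι A) (hXY : Commute X Y) :
    (X * mcomm D Y).trace = 0 := by
  rw [mcomm, mul_sub, Matrix.trace_sub, ← mul_assoc, ← mul_assoc, Matrix.trace_mul_comm,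
    ← mul_assoc, hXY.eq, sub_self]

/-- The bracket of traces of powers is a multiple of a trace against the tensor bracket. -/
theorem PoissonR.br_trace_pow_succ {A ι κ : Type*} [CommRing A] [Fintype ι] [DecidableEq ι]
    [Fintype κ] [DecidableEq κ] (P : PoissonR A) (M : Matrix ι ι A) (N : Matrix κ κ A)
    (k m : ℕ) :
    P.br (M ^ (k + 1)).trace (N ^ (m + 1)).trace =
      (m + 1) * (k + 1) * (((M ^ k) ⊗ₖ (N ^ m)) *
        (Matrix.of fun p q : ι × κ => P.br (M p.1 q.1) (N p.2 q.2))).trace := by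
  have hM (y : A) : P.br (M ^ (k + 1)).trace y =
      (k + 1) * (M ^ k * Matrix.of fun i j => P.br (M i j) y).trace := by
    have hneg : M.map (P.hamiltonian y) = -Matrix.of fun i j => P.br (M i j) y := by
      ext i j
      exact P.antisymm _ _
    rw [P.antisymm, ← P.hamiltonian_apply, Derivation.map_trace_pow_succ, hneg, mul_neg,
      Matrix.trace_neg, mul_neg, neg_neg]
  have hN : N.map (P.hamiltonian (M ^ (k + 1)).trace) = Matrix.of fun l' l =>
      (k + 1) * (M ^ k * Matrix.of fun i j => P.br (M i j) (N l' l)).trace := by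
    ext l' l
    exact hM _
  rw [← P.hamiltonian_apply, Derivation.map_trace_pow_succ, hN, mul_assoc]
  congr 1
  simp only [Matrix.trace, Matrix.diag_apply, Matrix.mul_apply, Matrix.of_apply, Matrix.kroneckerMap_apply, Fintype.sum_prod_type,
    Finset.mul_sum]
  calc
    _ = ∑ l, ∑ i, ∑ l', ∑ i', (k + 1) * (M ^ k) i i' * (N ^ m) l l' * P.br (M i' i) (N l' l) := by
      refine Finset.sum_congr rfl fun l _ => ?_
      rw [Finset.sum_comm]
      refine Finset.sum_congr rfl fun i _ => Finset.sum_congr rfl fun l' _ =>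
        Finset.sum_congr rfl fun i' _ => by ring
    _ = _ := by
      rw [Finset.sum_comm]
      refine Finset.sum_congr rfl fun i _ => Finset.sum_congr rfl fun l _ => ?_
      rw [Finset.sum_comm]
      exact Finset.sum_congr rfl fun i' _ => Finset.sum_congr rfl fun l' _ => by ring

/-- if `{P ⊗, Q} = [D₁₂, P⊗I] + [D₂₁, I⊗Q]` then all spectral invariants are
in involution: `{tr(P^k), tr(Q^m)} = 0`. -/
theorem statement5 {A : Type*} [CommRing A] (P : PoissonR A) {n n' : ℕ}
    (Pm : Matrix (Fin n) (Fin n) A) (Qm : Matrix (Fin n') (Fin n') A)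
    (D12 D21 : Matrix (Fin n × Fin n') (Fin n × Fin n') A)
    (h : (Matrix.of fun p q => P.br (Pm p.1 q.1) (Qm p.2 q.2))
      = mcomm D12 (Pm ⊗ₖ (1 : Matrix (Fin n') (Fin n') A))
        + mcomm D21 ((1 : Matrix (Fin n) (Fin n) A) ⊗ₖ Qm)) :
    ∀ k m : ℕ, 1 ≤ k → 1 ≤ m → P.br (Pm ^ k).trace (Qm ^ m).trace = 0 := by
  intro k m hk hm
  obtain ⟨k, rfl⟩ := Nat.exists_eq_add_of_le' hk
  obtain ⟨m, rfl⟩ := Nat.exists_eq_add_of_le' hm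
  have hP : Commute ((Pm ^ k) ⊗ₖ (Qm ^ m)) (Pm ⊗ₖ (1 : Matrix (Fin n') (Fin n') A)) := by
    rw [commute_iff_eq, ← Matrix.mul_kronecker_mul, ← Matrix.mul_kronecker_mul, ← pow_succ,
      ← pow_succ', mul_one, one_mul]
  have hQ : Commute ((Pm ^ k) ⊗ₖ (Qm ^ m)) ((1 : Matrix (Fin n) (Fin n) A) ⊗ₖ Qm) := by
    rw [commute_iff_eq, ← Matrix.mul_kronecker_mul, ← Matrix.mul_kronecker_mul, ← pow_succ,
      ← pow_succ', mul_one, one_mul]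
  rw [P.br_trace_pow_succ, h, Matrix.mul_add, Matrix.trace_add, trace_mul_mcomm_of_commute _ hP,
    trace_mul_mcomm_of_commute _ hQ, add_zero, mul_zero]
end

section
/- Let A be a Poisson algebra that is a ℚ-algebra, and let L and L' be traceless 2×2 matrices over A. Suppose there exist 4×4 matrices D₁₂ and D₂₁ over A such that {L ⊗, L'} = [D₁₂, L⊗I] + [D₂₁, I⊗L']. Then the determinants Poisson-commute: {det L, det L'} = 0. In particular, for a traceless 2×2 Lax matrix satisfying a linear rs-matrix algebra, the determinant is a generating function of integrals of motion in involution. -/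
open Matrix Kronecker

namespace PoissonR

variable {A : Type*} [CommRing A] (P : PoissonR A)

theorem leibniz_left (x y z : A) : P.br (x * y) z = P.br x z * y + x * P.br y z := by
  rw [P.antisymm, P.leibniz, P.antisymm z x, P.antisymm z y]
  ring

theorem sub_left (x y z : A) : P.br (x - y) z = P.br x z - P.br y z := by
  rw [eq_sub_iff_add_eq, ← P.add_left, sub_add_cancel]

theorem sub_right (x y z : A) : P.br x (y - z) = P.br x y - P.br x z := by
  rw [eq_sub_iff_add_eq, ← P.add_right, sub_add_cancel]

/-- Jacobi's formula for the bracket of two `2 × 2` determinants. -/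
theorem br_det_det (L L' : Matrix (Fin 2) (Fin 2) A) :
    P.br L.det L'.det = ((L.adjugate ⊗ₖ L'.adjugate) *
      Matrix.of fun p q : Fin 2 × Fin 2 => P.br (L p.1 q.1) (L' p.2 q.2)).trace := by
  simp only [det_fin_two, sub_left, sub_right, leibniz_left, leibniz, trace, diag_apply,
    mul_apply, kroneckerMap_apply, of_apply, adjugate_fin_two, Fintype.sum_prod_type,
    Fin.sum_univ_two, cons_val_zero, cons_val_one]
  ring

end PoissonR

/-- for traceless 2×2 Lax matrices obeying a linear rs-matrix algebra,
the determinants Poisson-commute. -/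
theorem statement7 {A : Type*} [CommRing A] [Algebra ℚ A] (P : PoissonR A)
    (L L' : Matrix (Fin 2) (Fin 2) A)
    (hL : L.trace = 0) (hL' : L'.trace = 0)
    (D12 D21 : Matrix (Fin 2 × Fin 2) (Fin 2 × Fin 2) A)
    (h : (Matrix.of fun p q => P.br (L p.1 q.1) (L' p.2 q.2))
      = mcomm D12 (L ⊗ₖ (1 : Matrix (Fin 2) (Fin 2) A))
        + mcomm D21 ((1 : Matrix (Fin 2) (Fin 2) A) ⊗ₖ L')) :
    P.br L.det L'.det = 0 := by
  rw [P.br_det_det, h, mul_add, trace_add, trace_mul_mcomm_of_commute, trace_mul_mcomm_of_commute,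
    add_zero]
  · simp only [Commute, SemiconjBy, ← mul_kronecker_mul, mul_one, one_mul, adjugate_mul,
      mul_adjugate]
  · simp only [Commute, SemiconjBy, ← mul_kronecker_mul, mul_one, one_mul, adjugate_mul,
      mul_adjugate]
end

section
/- Fix n ≥ 1 and let A be the polynomial ring over ℂ in 2n variables u₁,…,u_n, v₁,…,v_n, equipped with the canonical Poisson bracket {F, G} = Σ_{i=1}^n (∂F/∂v_i·∂G/∂u_i − ∂F/∂u_i·∂G/∂v_i) (so {v_i, u_j} = δ_{ij}). Define in A[X]: b(λ) = Π_{k=1}^n (λ − u_k); Δ = Π_{l≠m} (u_l − u_m) (product over all ordered pairs l ≠ m); and the Lagrange-interpolation numerator ã(λ) = Σ_{i=1}^n v_i · ( Π_{l≠m, l≠i} (u_l − u_m) ) · Π_{k≠i} (λ − u_k). Then, as an identity in A[λ,μ]: (λ−μ)·{ã(λ), b(μ)} = Δ·( b(μ) − b(λ) ). (This is the denominator-cleared form of the relation {a(λ), b(μ)} = (b(μ)−b(λ))/(λ−μ) for a = ã/Δ, verifying that the separated Lax matrix built from root coordinates u_k and conjugate momenta v_k obeys the rational linear r-matrix algebra.)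 -/
open Polynomial

/-- The phase-space algebra `A = ℂ[u₁,…,u_n, v₁,…,v_n]`. -/
abbrev PhaseAlg (n : ℕ) := MvPolynomial (Fin n ⊕ Fin n) ℂ

/-- The coordinate `u_i`. -/
noncomputable def uu {n : ℕ} (i : Fin n) : PhaseAlg n := MvPolynomial.X (Sum.inl i)

/-- The momentum `v_i`. -/
noncomputable def vv {n : ℕ} (i : Fin n) : PhaseAlg n := MvPolynomial.X (Sum.inr i)

/-- The canonical Poisson bracket
`{F, G} = Σ_i (∂F/∂v_i·∂G/∂u_i − ∂F/∂u_i·∂G/∂v_i)`, so `{v_i, u_j} = δ_{ij}`. -/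
noncomputable def pb {n : ℕ} (F G : PhaseAlg n) : PhaseAlg n :=
  ∑ i : Fin n,
    (MvPolynomial.pderiv (Sum.inr i) F * MvPolynomial.pderiv (Sum.inl i) G
      - MvPolynomial.pderiv (Sum.inl i) F * MvPolynomial.pderiv (Sum.inr i) G)

/-- The two-variable bracket `{p(λ), q(μ)} = Σ_{i,j} {p_i, q_j} λ^i μ^j` as an element of
`A[λ,μ] = (A[μ])[λ]` (outer variable `λ`, inner variable `μ`). -/
noncomputable def br2 {n : ℕ} (p q : Polynomial (PhaseAlg n)) :
    Polynomial (Polynomial (PhaseAlg n)) :=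
  ∑ i ∈ p.support, ∑ j ∈ q.support,
    Polynomial.C (Polynomial.C (pb (p.coeff i) (q.coeff j)) * Polynomial.X ^ j)
      * Polynomial.X ^ i

open Finset in
/-- The product rule for a derivation applied to a finite product. -/
theorem Derivation.map_prod_eq_sum {R B ι : Type*} [CommRing R] [CommRing B] [Algebra R B]
    [DecidableEq ι] (d : Derivation R B B) (s : Finset ι) (f : ι → B) :
    d (∏ i ∈ s, f i) = ∑ i ∈ s, (∏ j ∈ s.erase i, f j) * d (f i) := by
  induction s using Finset.induction_on with
  | empty => simp
  | insert a s ha ih =>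
    rw [prod_insert ha, d.leibniz, ih, sum_insert ha, erase_insert ha, smul_eq_mul, smul_eq_mul,
      add_comm, mul_sum]
    congr 1
    refine sum_congr rfl fun i hi => ?_
    have hne : a ≠ i := fun h => ha (h ▸ hi)
    rw [erase_insert_of_ne hne, prod_insert (fun h => ha (mem_of_mem_erase h)), mul_assoc]

/-- The derivation of `B[X]` acting by `d` on each coefficient. -/
noncomputable def coeffDer {R B : Type*} [CommRing R] [CommRing B] [Algebra R B]
    (d : Derivation R B B) : Derivation R B[X] B[X] :=
  PolynomialModule.equivPolynomialSelf.toLinearMap.compDer d.mapCoeffs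

theorem coeff_coeffDer {R B : Type*} [CommRing R] [CommRing B] [Algebra R B]
    (d : Derivation R B B) (p : B[X]) (i : ℕ) :
    (coeffDer d p).coeff i = d (p.coeff i) := rfl

theorem coeffDer_C {R B : Type*} [CommRing R] [CommRing B] [Algebra R B]
    (d : Derivation R B B) (a : B) : coeffDer d (C a) = C (d a) := by
  ext i
  rw [coeff_coeffDer, coeff_C, coeff_C]
  split_ifs <;> simp

theorem coeffDer_X {R B : Type*} [CommRing R] [CommRing B] [Algebra R B]
    (d : Derivation R B B) : coeffDer d (X : B[X]) = 0 := by
  ext i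
  rw [coeff_coeffDer, coeff_X]
  split_ifs <;> simp

theorem coeff_coeff_br2 {n : ℕ} (p q : (PhaseAlg n)[X]) (i j : ℕ) :
    ((br2 p q).coeff i).coeff j = pb (p.coeff i) (q.coeff j) := by
  have h₁ : ∀ G : PhaseAlg n, pb 0 G = 0 := fun G => by simp [pb]
  have h₂ : ∀ F : PhaseAlg n, pb F 0 = 0 := fun F => by simp [pb]
  simp only [br2, finsetSum_coeff, coeff_C_mul, coeff_X_pow, mul_ite, mul_one, mul_zero]
  rw [Finset.sum_eq_single i, Finset.sum_eq_single j]
  · simp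
  · intro k _ hk
    simp [coeff_X_pow, hk.symm]
  · intro hj
    simp [notMem_support_iff.1 hj, h₂]
  · intro k _ hk
    simp [hk.symm]
  · intro hi
    simp [notMem_support_iff.1 hi, h₁]

theorem br2_eq_sum {n : ℕ} (p q : (PhaseAlg n)[X]) :
    br2 p q = ∑ s : Fin n,
      ((coeffDer (MvPolynomial.pderiv (Sum.inr s)) p).map C
          * C (coeffDer (MvPolynomial.pderiv (Sum.inl s)) q)
        - (coeffDer (MvPolynomial.pderiv (Sum.inl s)) p).map C
          * C (coeffDer (MvPolynomial.pderiv (Sum.inr s)) q)) := by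
  ext1 i
  ext1 j
  rw [coeff_coeff_br2, pb]
  simp only [finsetSum_coeff, coeff_sub, coeff_mul_C, coeff_map, coeff_C_mul, coeff_coeffDer]

theorem uu_injective {n : ℕ} : Function.Injective (uu : Fin n → PhaseAlg n) :=
  fun _ _ h => Sum.inl_injective (MvPolynomial.X_injective h)

/-- Lagrange interpolation of the constant polynomial, with denominators cleared. -/
theorem sum_C_mul_prod_X_sub_C {B ι : Type*} [CommRing B] [IsDomain B] [Fintype ι] [Nonempty ι]
    [DecidableEq ι] (u : ι → B) (hu : Function.Injective u) (c : ι → B) (δ : B)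
    (hc : ∀ i, c i * ∏ k ∈ Finset.univ.erase i, (u i - u k) = δ) :
    ∑ i, C (c i) * ∏ k ∈ Finset.univ.erase i, (X - C (u k)) = C δ := by
  have hpos : 0 < Fintype.card ι := Fintype.card_pos
  refine eq_of_degrees_lt_of_eval_index_eq (v := u) Finset.univ hu.injOn ?_ ?_ ?_
  · rw [← mem_degreeLT]
    refine Submodule.sum_mem _ fun i _ => ?_
    rw [← smul_eq_C_mul, mem_degreeLT]
    refine lt_of_le_of_lt (degree_smul_le _ _) ?_
    rw [degree_prod]
    simp only [degree_X_sub_C, Finset.sum_const, nsmul_eq_mul, mul_one,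
      Finset.card_erase_of_mem (Finset.mem_univ i), Finset.card_univ]
    exact_mod_cast Nat.sub_lt hpos one_pos
  · exact lt_of_le_of_lt degree_C_le (by simpa using hpos)
  · intro j _
    rw [eval_finsetSum, Finset.sum_eq_single j]
    · simp [eval_prod, hc]
    · intro i _ hij
      rw [eval_mul, eval_prod, Finset.prod_eq_zero (Finset.mem_erase.2 ⟨hij.symm, Finset.mem_univ j⟩),
        mul_zero]
      simp
    · simp

theorem bivariate_sum_eq_of_interpolation {B ι : Type*} [CommRing B] [Fintype ι]
    [DecidableEq ι] (u c : ι → B) (δ : B)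
    (hsum : ∑ i, C (c i) * ∏ k ∈ Finset.univ.erase i, (X - C (u k)) = C δ) :
    (X - C X) * ∑ i, (C (c i) * ∏ k ∈ Finset.univ.erase i, (X - C (u k))).map C
        * C (-∏ k ∈ Finset.univ.erase i, (X - C (u k)))
      = C (C δ) * (C (∏ k, (X - C (u k))) - (∏ k, (X - C (u k))).map C) := by
  set P : ι → B[X] := fun i => ∏ k ∈ Finset.univ.erase i, (X - C (u k))
  set b : B[X] := ∏ k, (X - C (u k))
  have hfac (i : ι) : b = (X - C (u i)) * P i :=
    (Finset.mul_prod_erase _ _ (Finset.mem_univ i)).symm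
  have hterm (i : ι) :
      (X - C X) * ((C (c i) * P i).map C * C (-P i))
        = C b * (C (c i) * P i).map C - b.map C * C (C (c i) * P i) := by
    rw [hfac i]
    simp only [Polynomial.map_mul, Polynomial.map_sub, map_X, map_C, C_mul, C_sub, C_neg]
    ring
  rw [Finset.mul_sum, Finset.sum_congr rfl fun i _ => hterm i, Finset.sum_sub_distrib,
    ← Finset.mul_sum, ← Finset.mul_sum, ← map_sum, ← Polynomial.map_sum, hsum, map_C]
  ring

theorem prod_ne_eq_mul_prod_erase {B : Type*} [CommRing B] {n : ℕ} (u : Fin n → B) (i : Fin n) :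
    (∏ p ∈ Finset.univ.filter (fun p : Fin n × Fin n => p.1 ≠ p.2 ∧ p.1 ≠ i), (u p.1 - u p.2))
        * ∏ k ∈ Finset.univ.erase i, (u i - u k)
      = ∏ p ∈ Finset.univ.filter (fun p : Fin n × Fin n => p.1 ≠ p.2), (u p.1 - u p.2) := by
  have h : ∏ k ∈ Finset.univ.erase i, (u i - u k) =
      ∏ p ∈ Finset.univ.filter (fun p : Fin n × Fin n => p.1 ≠ p.2 ∧ ¬ p.1 ≠ i),
        (u p.1 - u p.2) := by
    refine Finset.prod_bij (fun k _ => (i, k)) ?_ ?_ ?_ ?_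
    · intro k hk
      simpa [eq_comm] using hk
    · intro a _ b _ hab
      exact (Prod.mk.inj hab).2
    · rintro ⟨a, b⟩ hab
      simp only [Finset.mem_filter, Finset.mem_univ, true_and, not_not] at hab
      obtain ⟨hab, rfl⟩ := hab
      exact ⟨b, by simpa [eq_comm] using hab, rfl⟩
    · intro k _
      rfl
  rw [h, ← Finset.filter_filter, ← Finset.filter_filter, Finset.prod_filter_mul_prod_filter_not]

theorem pderiv_inr_prod_uu_sub {n : ℕ} (s : Fin n) (t : Finset (Fin n × Fin n)) :
    MvPolynomial.pderiv (Sum.inr s) (∏ p ∈ t, (uu p.1 - uu p.2) : PhaseAlg n) = 0 := by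
  classical
  rw [Derivation.map_prod_eq_sum]
  exact Finset.sum_eq_zero fun p _ => by simp [uu, MvPolynomial.pderiv_X]

theorem coeffDer_inr_prod_X_sub {n : ℕ} (s : Fin n) (t : Finset (Fin n)) :
    coeffDer (MvPolynomial.pderiv (Sum.inr s))
      (∏ k ∈ t, (X - C (uu k)) : (PhaseAlg n)[X]) = 0 := by
  rw [Derivation.map_prod_eq_sum]
  exact Finset.sum_eq_zero fun k _ => by
    simp [coeffDer_X, coeffDer_C, uu, MvPolynomial.pderiv_X]

theorem coeffDer_inl_prod_X_sub {n : ℕ} (s : Fin n) :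
    coeffDer (MvPolynomial.pderiv (Sum.inl s))
        (∏ k : Fin n, (X - C (uu k)) : (PhaseAlg n)[X])
      = -∏ k ∈ Finset.univ.erase s, (X - C (uu k)) := by
  rw [Derivation.map_prod_eq_sum, Finset.sum_eq_single s]
  · simp [coeffDer_X, coeffDer_C, uu]
  · intro k _ hk
    simp [coeffDer_X, coeffDer_C, uu, MvPolynomial.pderiv_X, hk]
  · simp

theorem coeffDer_inr_interpolant {n : ℕ} (s : Fin n) (c : Fin n → PhaseAlg n)
    (hc : ∀ i, MvPolynomial.pderiv (Sum.inr s) (c i) = 0) :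
    coeffDer (MvPolynomial.pderiv (Sum.inr s))
        (∑ i : Fin n, C (vv i * c i) * ∏ k ∈ Finset.univ.erase i, (X - C (uu k)))
      = C (c s) * ∏ k ∈ Finset.univ.erase s, (X - C (uu k)) := by
  have h (i : Fin n) : coeffDer (MvPolynomial.pderiv (Sum.inr s))
      (C (vv i * c i) * ∏ k ∈ Finset.univ.erase i, (X - C (uu k)))
        = if i = s then C (c i) * ∏ k ∈ Finset.univ.erase i, (X - C (uu k)) else 0 := by
    rw [Derivation.leibniz, coeffDer_inr_prod_X_sub, coeffDer_C, Derivation.leibniz, hc, vv]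
    by_cases his : i = s
    · subst his
      simp [mul_comm]
    · simp [his, MvPolynomial.pderiv_X]
  rw [map_sum, Finset.sum_congr rfl fun i _ => h i]
  simp

/-- the denominator-cleared rational r-matrix relation
`(λ−μ)·{ã(λ), b(μ)} = Δ·(b(μ) − b(λ))` for the Lagrange-interpolation data built from the
root coordinates `u_k` and conjugate momenta `v_k`. -/
theorem statement12 (n : ℕ) (hn : 1 ≤ n)
    (b : Polynomial (PhaseAlg n))
    (hb : b = ∏ k : Fin n, (Polynomial.X - Polynomial.C (uu k)))
    (Δ : PhaseAlg n)
    (hΔ : Δ = ∏ p ∈ Finset.univ.filter (fun p : Fin n × Fin n => p.1 ≠ p.2),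
        (uu p.1 - uu p.2))
    (atil : Polynomial (PhaseAlg n))
    (hatil : atil = ∑ i : Fin n,
      Polynomial.C (vv i *
          ∏ p ∈ Finset.univ.filter (fun p : Fin n × Fin n => p.1 ≠ p.2 ∧ p.1 ≠ i),
            (uu p.1 - uu p.2))
        * ∏ k ∈ Finset.univ.erase i, (Polynomial.X - Polynomial.C (uu k))) :
    (Polynomial.X - Polynomial.C Polynomial.X) * br2 atil b
      = Polynomial.C (Polynomial.C Δ) * (Polynomial.C b - b.map Polynomial.C) := by
  have : Nonempty (Fin n) := ⟨⟨0, hn⟩⟩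
  set c : Fin n → PhaseAlg n := fun i =>
    ∏ p ∈ Finset.univ.filter (fun p : Fin n × Fin n => p.1 ≠ p.2 ∧ p.1 ≠ i),
      (uu p.1 - uu p.2)
  have hbr : br2 atil b = ∑ s : Fin n,
      (C (c s) * ∏ k ∈ Finset.univ.erase s, (X - C (uu k))).map C
        * C (-∏ k ∈ Finset.univ.erase s, (X - C (uu k))) := by
    rw [br2_eq_sum]
    refine Finset.sum_congr rfl fun s _ => ?_
    rw [hatil, coeffDer_inr_interpolant s c fun i => pderiv_inr_prod_uu_sub s _, hb,
      coeffDer_inl_prod_X_sub, coeffDer_inr_prod_X_sub, C_0, mul_zero, sub_zero]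
  have hsum : ∑ i, C (c i) * ∏ k ∈ Finset.univ.erase i, (X - C (uu k)) = C Δ :=
    sum_C_mul_prod_X_sub_C uu uu_injective c Δ fun i => by
      rw [hΔ]
      exact prod_ne_eq_mul_prod_erase uu i
  rw [hbr, hb]
  exact bivariate_sum_eq_of_interpolation uu c Δ hsum
end
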